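/- Let d ≥ 1, m ≥ -d, σ > 0, let h_t be the Mehler heat kernel of L = -Δ + |x|² + m, fix A > 0 with tanh(A) = 1/2, and set K(x,y) = ∫₀^A h_t(x,y) t^{-(1+σ)} dt. Then there exist constants c = c(σ,d,m) > 0 and γ > 0 such that K(x,y) ≤ c e^{-(1/2+γ)|y|²} whenever |y| ≥ 10 max{|x|, 1}. -/

import Mathlib

open MeasureTheory Set Filter
open RealInnerProductSpace

/-- The Mehler heat kernel of the Hermite-type operator `L = -Δ + |x|² + m` on `ℝ^d`. -/
noncomputable def mehler (d : ℕ) (m : ℝ) (t : ℝ)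
    (x y : EuclideanSpace ℝ (Fin d)) : ℝ :=
  Real.exp (-t * m) * (2 * Real.pi * Real.sinh (2 * t)) ^ (-(d : ℝ) / 2) *
    Real.exp (-‖x - y‖ ^ 2 / (2 * Real.tanh (2 * t)) - Real.tanh t * ⟪x, y⟫)

theorem Real.tanh_two_mul_eq (t : ℝ) :
    Real.tanh (2 * t) = 2 * Real.tanh t / (1 + Real.tanh t ^ 2) := by
  have hc := Real.cosh_pos t
  rw [Real.tanh_eq_sinh_div_cosh, Real.tanh_eq_sinh_div_cosh, Real.sinh_two_mul,
    Real.cosh_two_mul]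
  have : 0 < Real.cosh t ^ 2 + Real.sinh t ^ 2 := by positivity
  field_simp

theorem Real.tanh_pos_of_pos {t : ℝ} (ht : 0 < t) : 0 < Real.tanh t := by
  rw [Real.tanh_eq_sinh_div_cosh]
  exact div_pos (Real.sinh_pos_iff.2 ht) (Real.cosh_pos t)

theorem Real.tanh_le_tanh_of_le {s t : ℝ} (h : s ≤ t) : Real.tanh s ≤ Real.tanh t := by
  rw [Real.tanh_eq_sinh_div_cosh, Real.tanh_eq_sinh_div_cosh,
    div_le_div_iff₀ (Real.cosh_pos s) (Real.cosh_pos t)]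
  have := Real.sinh_nonneg_iff.2 (sub_nonneg.2 h)
  rw [Real.sinh_sub] at this
  linarith

theorem Real.tanh_le_two_mul {t : ℝ} (ht : 0 ≤ t) : Real.tanh t ≤ 2 * t := by
  have hexp : Real.exp (-t) = Real.exp t * Real.exp (-(2 * t)) := by
    rw [← Real.exp_add]; ring_nf
  have h1 : Real.exp t - Real.exp (-t) ≤ 2 * t * Real.exp t := by
    rw [hexp]
    nlinarith [Real.exp_pos t, Real.add_one_le_exp (-(2 * t))]
  rw [Real.tanh_eq, div_le_iff₀ (by positivity)]
  nlinarith [mul_nonneg ht (Real.exp_pos (-t)).le]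

/-- Powers of `s > 0` are dominated by exponentials with arbitrarily small rate. -/
theorem Real.rpow_le_const_mul_exp {p b s : ℝ} (hp : 0 < p) (hb : 0 < b) (hs : 0 < s) :
    s ^ p ≤ (b / p) ^ (-p) * Real.exp (b * s) := by
  have hbp : 0 < b / p := by positivity
  have h : (b / p * s) ^ p ≤ Real.exp (b * s) := by
    calc (b / p * s) ^ p ≤ Real.exp (b / p * s) ^ p := by
          gcongr
          linarith [Real.add_one_le_exp (b / p * s)]
      _ = Real.exp (b * s) := by
          rw [← Real.exp_mul]
          congr 1
          field_simp
  calc s ^ p = (b / p) ^ (-p) * (b / p * s) ^ p := by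
        rw [Real.mul_rpow hbp.le hs.le, ← mul_assoc, ← Real.rpow_add hbp]
        simp
    _ ≤ _ := by gcongr

/-- The exponent of Mehler's formula in terms of `τ = tanh t`. -/
theorem mehler_exponent_le {E : Type*} [NormedAddCommGroup E] [InnerProductSpace ℝ E]
    {x y : E} {τ : ℝ} (h0 : 0 < τ) (h1 : τ ≤ 1 / 2) (hxy : 10 * ‖x‖ ≤ ‖y‖) :
    -‖x - y‖ ^ 2 / (2 * (2 * τ / (1 + τ ^ 2))) - τ * ⟪x, y⟫ ≤
      -(1 / 2 + 1 / 250) * ‖y‖ ^ 2 - ‖y‖ ^ 2 / (1000 * τ) := by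
  have hx := norm_nonneg x
  have hy := norm_nonneg y
  have hsub : (81 / 100) * ‖y‖ ^ 2 ≤ ‖x - y‖ ^ 2 := by
    have := norm_sub_norm_le y x
    rw [norm_sub_rev] at this
    nlinarith
  have hadd : (81 / 100) * ‖y‖ ^ 2 ≤ ‖x + y‖ ^ 2 := by
    have := norm_sub_norm_le y (-x)
    rw [sub_neg_eq_add, norm_neg, add_comm] at this
    nlinarith
  have hin : ⟪x, y⟫ = (‖x + y‖ ^ 2 - ‖x - y‖ ^ 2) / 4 := by
    rw [norm_add_sq_real, norm_sub_sq_real]; ring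
  have hlhs : -‖x - y‖ ^ 2 / (2 * (2 * τ / (1 + τ ^ 2))) - τ * ⟪x, y⟫ =
      -(‖x - y‖ ^ 2 + τ ^ 2 * ‖x + y‖ ^ 2) / (4 * τ) := by
    rw [hin]; field_simp; ring
  have hrhs : -(1 / 2 + 1 / 250) * ‖y‖ ^ 2 - ‖y‖ ^ 2 / (1000 * τ) =
      -((4 * (1 / 2 + 1 / 250) * τ + 1 / 250) * ‖y‖ ^ 2) / (4 * τ) := by
    field_simp; ring
  rw [hlhs, hrhs]
  gcongr
  calc (4 * (1 / 2 + 1 / 250) * τ + 1 / 250) * ‖y‖ ^ 2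
      ≤ (81 / 100 + τ ^ 2 * (81 / 100)) * ‖y‖ ^ 2 := by
        refine mul_le_mul_of_nonneg_right ?_ (sq_nonneg _)
        nlinarith
    _ ≤ ‖x - y‖ ^ 2 + τ ^ 2 * ‖x + y‖ ^ 2 := by
        nlinarith [mul_le_mul_of_nonneg_left hadd (sq_nonneg τ)]

/-- Pointwise Gaussian bound for the integrand, uniform in `t` with `tanh t ≤ 1/2`. -/
theorem mehler_mul_rpow_le {d : ℕ} {m σ A t : ℝ} (hσ : 0 < σ) (ht : 0 < t) (htA : t ≤ A)
    (hA : Real.tanh A = 1 / 2) {x y : EuclideanSpace ℝ (Fin d)} (hxy : 10 * max ‖x‖ 1 ≤ ‖y‖) :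
    mehler d m t x y * t ^ (-(1 + σ)) ≤
      Real.exp (A * |m|) * (1 / 20 / ((d : ℝ) / 2 + (1 + σ))) ^ (-((d : ℝ) / 2 + (1 + σ))) *
        Real.exp (-(1 / 2 + 1 / 250) * ‖y‖ ^ 2) := by
  set p : ℝ := (d : ℝ) / 2 + (1 + σ) with hp_def
  have hp : 0 < p := by positivity
  have hy : 10 ≤ ‖y‖ := by linarith [le_max_right ‖x‖ 1]
  have hτ0 := Real.tanh_pos_of_pos ht
  have hτ1 : Real.tanh t ≤ 1 / 2 := hA ▸ Real.tanh_le_tanh_of_le htA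
  have hm : Real.exp (-t * m) ≤ Real.exp (A * |m|) := by
    refine Real.exp_le_exp.2 ?_
    calc -t * m = t * -m := by ring
      _ ≤ t * |m| := by gcongr; exact neg_le_abs m
      _ ≤ A * |m| := by gcongr
  have hsinh : (2 * Real.pi * Real.sinh (2 * t)) ^ (-(d : ℝ) / 2) ≤ t ^ (-(d : ℝ) / 2) := by
    refine Real.rpow_le_rpow_of_nonpos ht ?_ ?_
    · have := Real.self_le_sinh_iff.2 (by positivity : 0 ≤ 2 * t)
      nlinarith [Real.pi_gt_three]
    · have : (0 : ℝ) ≤ d := by positivity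
      linarith
  have hexp : Real.exp (-‖x - y‖ ^ 2 / (2 * Real.tanh (2 * t)) - Real.tanh t * ⟪x, y⟫) ≤
      Real.exp (-(1 / 2 + 1 / 250) * ‖y‖ ^ 2) * Real.exp (-(1 / 20 * t⁻¹)) := by
    rw [← Real.exp_add, Real.tanh_two_mul_eq]
    gcongr
    refine (mehler_exponent_le hτ0 hτ1 (by linarith [le_max_left ‖x‖ 1])).trans ?_
    rw [sub_eq_add_neg]
    gcongr
    calc 1 / 20 * t⁻¹ = 100 / (1000 * (2 * t)) := by field_simp; norm_num
      _ ≤ ‖y‖ ^ 2 / (1000 * Real.tanh t) := by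
        gcongr
        · nlinarith
        · exact Real.tanh_le_two_mul ht.le
  have hpow : t ^ (-(d : ℝ) / 2) * t ^ (-(1 + σ)) * Real.exp (-(1 / 20 * t⁻¹)) ≤
      (1 / 20 / p) ^ (-p) := by
    rw [← Real.rpow_add ht, Real.exp_neg, ← div_eq_mul_inv, div_le_iff₀ (Real.exp_pos _)]
    calc t ^ (-(d : ℝ) / 2 + -(1 + σ)) = t⁻¹ ^ p := by
          rw [Real.inv_rpow ht.le, ← Real.rpow_neg ht.le]
          congr 1
          rw [hp_def]; ring
      _ ≤ _ := Real.rpow_le_const_mul_exp hp (by norm_num) (by positivity)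
  unfold mehler
  calc _ ≤ Real.exp (A * |m|) * t ^ (-(d : ℝ) / 2) *
        (Real.exp (-(1 / 2 + 1 / 250) * ‖y‖ ^ 2) * Real.exp (-(1 / 20 * t⁻¹))) *
          t ^ (-(1 + σ)) := by gcongr
    _ = Real.exp (A * |m|) *
        (t ^ (-(d : ℝ) / 2) * t ^ (-(1 + σ)) * Real.exp (-(1 / 20 * t⁻¹))) *
          Real.exp (-(1 / 2 + 1 / 250) * ‖y‖ ^ 2) := by ring
    _ ≤ _ := by gcongr

/-- For the Mehler heat kernel of `L = -Δ + |x|² + m` and `A > 0` with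
`tanh A = 1/2`, the kernel `K(x,y) = ∫₀^A h_t(x,y) t^{-(1+σ)} dt` has gaussian decay:
there are `c > 0` and `γ > 0` with `K(x,y) ≤ c e^{-(1/2+γ)|y|²}` whenever
`|y| ≥ 10 max{|x|,1}`. -/
theorem mehler_truncated_kernel_gaussian_decay
    (d : ℕ) (hd : 1 ≤ d) (m : ℝ) (hm : -(d : ℝ) ≤ m) (σ : ℝ) (hσ : 0 < σ)
    (A : ℝ) (hA0 : 0 < A) (hA : Real.tanh A = 1 / 2) :
    ∃ c > (0 : ℝ), ∃ γ > (0 : ℝ), ∀ x y : EuclideanSpace ℝ (Fin d),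
      10 * max ‖x‖ 1 ≤ ‖y‖ →
      (∫ t in Set.Ioo (0 : ℝ) A, mehler d m t x y * t ^ (-(1 + σ)))
        ≤ c * Real.exp (-(1 / 2 + γ) * ‖y‖ ^ 2) := by
  have hC : 0 < Real.exp (A * |m|) *
      (1 / 20 / ((d : ℝ) / 2 + (1 + σ))) ^ (-((d : ℝ) / 2 + (1 + σ))) := by positivity
  refine ⟨_, mul_pos hC hA0, 1 / 250, by norm_num, fun x y hxy => ?_⟩
  have hbound := norm_setIntegral_le_of_norm_le_const
    (μ := volume) (s := Ioo 0 A) (f := fun t => mehler d m t x y * t ^ (-(1 + σ)))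
    (by simp) (fun t ht => by
      have h0 : 0 ≤ mehler d m t x y * t ^ (-(1 + σ)) := by
        have ht0 := ht.1
        have hsinh : 0 < Real.sinh (2 * t) := Real.sinh_pos_iff.2 (by linarith)
        unfold mehler
        positivity
      rw [Real.norm_of_nonneg h0]
      exact mehler_mul_rpow_le hσ ht.1 ht.2.le hA hxy)
  refine (Real.le_norm_self _).trans (hbound.trans_eq ?_)
  rw [Real.volume_real_Ioo_of_le hA0.le]
  ring
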